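/- (Self-similarity of the seminorm of fractional Brownian motion.) Let H ∈ (1/2,1), α ∈ (1−H, 1/2), and let B^H be a fractional Brownian motion with Hurst parameter H. Then for all 0 ≤ a < b, the random variable (b−a)^{−(H+α−1)} · ‖B^H‖_{0;[a,b]} has the same probability distribution as ‖B^H‖_{0;[0,1]}. -/

import Mathlib

open MeasureTheory Set
open scoped ENNReal NNReal

/-- The seminorm `‖g‖_{0;[a,b]}`, valued in `ℝ≥0∞`. -/
noncomputable def zeroNorm (α a b : ℝ) (g : ℝ → ℝ) : ℝ≥0∞ :=
  ⨆ (u : ℝ) (v : ℝ) (_ : a ≤ u) (_ : u < v) (_ : v < b),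
    ENNReal.ofReal (|g v - g u| / (v - u) ^ (1 - α)
      + ∫ z in Ioo u v, |g u - g z| / (z - u) ^ (2 - α))

/-- `B` is a fractional Brownian motion with Hurst parameter `H` on `(Ω, P)`:
almost all paths are continuous, every finite linear combination of values is
centered Gaussian, and the covariance is
`E[B_s B_t] = (s^{2H} + t^{2H} - |t-s|^{2H})/2` for `s, t ≥ 0`. -/
def IsFBM {Ω : Type*} [MeasurableSpace Ω] (P : Measure Ω) (H : ℝ)
    (B : Ω → ℝ → ℝ) : Prop :=
  (∀ᵐ ω ∂P, Continuous (B ω)) ∧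
  (∀ (n : ℕ) (c t : Fin n → ℝ), ∃ v : ℝ≥0,
    Measure.map (fun ω => ∑ i, c i * B ω (t i)) P = ProbabilityTheory.gaussianReal 0 v) ∧
  (∀ s t : ℝ, 0 ≤ s → 0 ≤ t
    → (∫ ω, B ω s * B ω t ∂P) = (s ^ (2 * H) + t ^ (2 * H) - |t - s| ^ (2 * H)) / 2)

open ProbabilityTheory Filter Topology

lemma gauss_aem {Ω : Type*} [MeasurableSpace Ω] {P : Measure Ω} {X : Ω → ℝ} {v : ℝ≥0}
    (h : Measure.map X P = gaussianReal 0 v) : AEMeasurable X P :=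
  aemeasurable_of_map_neZero (by rw [h]; infer_instance)

lemma gauss_sq {Ω : Type*} [MeasurableSpace Ω] {P : Measure Ω} {X : Ω → ℝ} {v : ℝ≥0}
    (h : Measure.map X P = gaussianReal 0 v) : ∫ ω, X ω ^ 2 ∂P = v := by
  have h1 := variance_fun_id_gaussianReal (μ := 0) (v := v)
  rw [variance_of_integral_eq_zero (by fun_prop) (by simp), ← h,
    integral_map (gauss_aem h) (by fun_prop)] at h1
  exact h1

lemma gauss_memLp {Ω : Type*} [MeasurableSpace Ω] {P : Measure Ω} {X : Ω → ℝ} {v : ℝ≥0}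
    (h : Measure.map X P = gaussianReal 0 v) : MemLp X 2 P := by
  have h1 := memLp_id_gaussianReal (μ := 0) (v := v) 2
  rw [← h, memLp_map_measure_iff (by fun_prop) (gauss_aem h)] at h1
  exact h1

/-- Covariance kernel. -/
noncomputable def covK (H s t : ℝ) : ℝ := (s ^ (2 * H) + t ^ (2 * H) - |t - s| ^ (2 * H)) / 2

section
variable {Ω : Type*} [MeasurableSpace Ω] {P : Measure Ω} {H : ℝ} {X Y : Ω → ℝ → ℝ}

lemma fbm_one (hX : IsFBM P H X) (t : ℝ) :
    ∃ v : ℝ≥0, Measure.map (fun ω => X ω t) P = gaussianReal 0 v := by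
  obtain ⟨v, hv⟩ := hX.2.1 1 (fun _ => 1) (fun _ => t)
  exact ⟨v, by simpa using hv⟩

lemma fbm_aem (hX : IsFBM P H X) (t : ℝ) : AEMeasurable (fun ω => X ω t) P :=
  let ⟨_, hv⟩ := fbm_one hX t; gauss_aem hv

lemma fbm_memLp (hX : IsFBM P H X) (t : ℝ) : MemLp (fun ω => X ω t) 2 P :=
  let ⟨_, hv⟩ := fbm_one hX t; gauss_memLp hv

lemma fbm_int (hX : IsFBM P H X) (s t : ℝ) : Integrable (fun ω => X ω s * X ω t) P :=
  (fbm_memLp hX s).integrable_mul (fbm_memLp hX t)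

lemma fbm_int2 (hX : IsFBM P H X) (s t s' t' : ℝ) :
    Integrable (fun ω => X ω s * X ω t - X ω s' * X ω t') P :=
  (fbm_int hX s t).sub (fbm_int hX s' t')

lemma fbm_var (hX : IsFBM P H X) {n : ℕ} (c t : Fin n → ℝ) (ht : ∀ i, 0 ≤ t i) :
    ∫ ω, (∑ i, c i * X ω (t i)) ^ 2 ∂P = ∑ i, ∑ j, c i * c j * covK H (t i) (t j) := by
  have : ∀ ω, (∑ i, c i * X ω (t i)) ^ 2
      = ∑ i, ∑ j, c i * c j * (X ω (t i) * X ω (t j)) := by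
    intro ω
    rw [sq, Finset.sum_mul_sum]
    refine Finset.sum_congr rfl fun i _ => Finset.sum_congr rfl fun j _ => by ring
  simp_rw [this]
  rw [integral_finsetSum _ (fun i _ => integrable_finsetSum _
    (fun j _ => (fbm_int hX _ _).const_mul _))]
  refine Finset.sum_congr rfl fun i _ => ?_
  rw [integral_finsetSum _ (fun j _ => (fbm_int hX _ _).const_mul _)]
  refine Finset.sum_congr rfl fun j _ => ?_
  rw [integral_const_mul, hX.2.2 _ _ (ht i) (ht j), covK]

lemma fbm_law_fin (hX : IsFBM P H X) (hY : IsFBM P H Y) {n : ℕ} (c t : Fin n → ℝ)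
    (ht : ∀ i, 0 ≤ t i) :
    Measure.map (fun ω => ∑ i, c i * X ω (t i)) P
      = Measure.map (fun ω => ∑ i, c i * Y ω (t i)) P := by
  obtain ⟨v, hv⟩ := hX.2.1 n c t
  obtain ⟨w, hw⟩ := hY.2.1 n c t
  have h1 := gauss_sq hv
  have h2 := gauss_sq hw
  rw [fbm_var hX c t ht] at h1
  rw [fbm_var hY c t ht] at h2
  have : v = w := by exact_mod_cast h1.symm.trans h2
  rw [hv, hw, this]

lemma fbm_law [IsProbabilityMeasure P] (hX : IsFBM P H X) (hY : IsFBM P H Y) :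
    Measure.map (fun ω => fun q : ℚ≥0 => X ω q) P
      = Measure.map (fun ω => fun q : ℚ≥0 => Y ω q) P := by
  have aX : AEMeasurable (fun ω => fun q : ℚ≥0 => X ω q) P :=
    aemeasurable_pi_lambda _ fun q => fbm_aem hX q
  have aY : AEMeasurable (fun ω => fun q : ℚ≥0 => Y ω q) P :=
    aemeasurable_pi_lambda _ fun q => fbm_aem hY q
  refine (map_eq_iff_forall_finset_map_restrict_eq (X := fun (q : ℚ≥0) ω => X ω q)
    (Y := fun (q : ℚ≥0) ω => Y ω q) aX aY).2 fun I => ?_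
  have bX : AEMeasurable (fun ω => I.restrict (fun q : ℚ≥0 => X ω q)) P :=
    (Finset.measurable_restrict _).comp_aemeasurable aX
  have bY : AEMeasurable (fun ω => I.restrict (fun q : ℚ≥0 => Y ω q)) P :=
    (Finset.measurable_restrict _).comp_aemeasurable aY
  have := Measure.isFiniteMeasure_map P (fun ω => I.restrict (fun q : ℚ≥0 => X ω q))
  have := Measure.isFiniteMeasure_map P (fun ω => I.restrict (fun q : ℚ≥0 => Y ω q))
  refine Measure.ext_of_charFunDual <| funext fun L ↦ ?_
  rw [charFunDual_eq_charFun_map_one, charFunDual_eq_charFun_map_one,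
    AEMeasurable.map_map_of_aemeasurable (by fun_prop) bX,
    AEMeasurable.map_map_of_aemeasurable (by fun_prop) bY]
  congr 1
  have key : ∀ Z : Ω → ℝ → ℝ, (L ∘ fun ω => I.restrict (fun q : ℚ≥0 => Z ω q))
      = fun ω => ∑ i : Fin (Fintype.card I),
        L (Pi.single ((Fintype.equivFin I).symm i) 1) *
          Z ω (((Fintype.equivFin I).symm i : ℚ≥0) : ℝ) := by
    intro Z
    ext ω
    rw [(Fintype.equivFin I).symm.sum_comp (fun i : I => L (Pi.single i 1) * Z ω ((i : ℚ≥0) : ℝ))]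
    have := (L : (I → ℝ) →ₗ[ℝ] ℝ).pi_apply_eq_sum_univ (I.restrict (fun q : ℚ≥0 => Z ω q))
    simp only [Function.comp]
    refine this.trans (Finset.sum_congr rfl fun i _ => ?_)
    simp only [ContinuousLinearMap.coe_coe, smul_eq_mul, Finset.restrict]
    rw [mul_comm]
    congr 2
    ext j
    simp [Pi.single_apply, eq_comm]
  rw [key X, key Y]
  rw [fbm_law_fin hX hY _ _ (fun i => by positivity)]

lemma fbm_affine (hX : IsFBM P H X) {a l : ℝ} (ha : 0 ≤ a) (hl : 0 < l) (hH : 0 < H) :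
    IsFBM P H (fun ω t => l ^ (-H) * (X ω (a + l * t) - X ω a)) := by
  refine ⟨?_, ?_, ?_⟩
  · filter_upwards [hX.1] with ω hω
    fun_prop
  · intro n c t
    obtain ⟨v, hv⟩ := hX.2.1 (n + 1) (Fin.cons (- ∑ i, c i * l ^ (-H)) (fun i => c i * l ^ (-H)))
      (Fin.cons a (fun i => a + l * t i))
    refine ⟨v, ?_⟩
    rw [← hv]
    congr 1
    ext ω
    rw [Fin.sum_univ_succ]
    simp only [Fin.cons_zero, Fin.cons_succ]
    rw [neg_mul, Finset.sum_mul, ← Finset.sum_neg_distrib, ← Finset.sum_add_distrib]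
    refine Finset.sum_congr rfl fun i _ => by ring
  · intro s t hs ht
    have hs' : 0 ≤ a + l * s := by positivity
    have ht' : 0 ≤ a + l * t := by positivity
    have e : ∀ ω, l ^ (-H) * (X ω (a + l * s) - X ω a) * (l ^ (-H) * (X ω (a + l * t) - X ω a))
        = l ^ (-H) * l ^ (-H) * ((X ω (a + l * s) * X ω (a + l * t) - X ω (a + l * s) * X ω a)
          - (X ω a * X ω (a + l * t) - X ω a * X ω a)) := fun ω => by ring
    simp_rw [e]
    rw [integral_const_mul, integral_sub (fbm_int2 hX _ _ _ _) (fbm_int2 hX _ _ _ _), integral_sub (fbm_int hX _ _) (fbm_int hX _ _),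
      integral_sub (fbm_int hX _ _) (fbm_int hX _ _), hX.2.2 _ _ hs' ht', hX.2.2 _ _ hs' ha,
      hX.2.2 _ _ ha ht', hX.2.2 _ _ ha ha]
    have e1 : |a + l * t - (a + l * s)| = l * |t - s| := by
      rw [show a + l * t - (a + l * s) = l * (t - s) by ring, abs_mul, abs_of_pos hl]
    have e2 : |a - (a + l * s)| = l * s := by
      rw [show a - (a + l * s) = - (l * s) by ring, abs_neg, abs_of_nonneg (by positivity)]
    have e3 : |a + l * t - a| = l * t := by
      rw [add_sub_cancel_left, abs_of_nonneg (by positivity)]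
    rw [e1, e2, e3, sub_self, abs_zero, Real.zero_rpow (by positivity),
      Real.mul_rpow hl.le (abs_nonneg _), Real.mul_rpow hl.le hs, Real.mul_rpow hl.le ht]
    have e4 : l ^ (-H) * l ^ (-H) * l ^ (2 * H) = 1 := by
      rw [← Real.rpow_add hl, ← Real.rpow_add hl]
      simp [show -H + -H + 2 * H = 0 by ring]
    linear_combination (s ^ (2 * H) + t ^ (2 * H) - |t - s| ^ (2 * H)) / 2 * e4

/-- Law of increments. -/
lemma fbm_incr (hX : IsFBM P H X) (hH : 0 < H) {s t : ℝ} (hs : 0 ≤ s) (ht : 0 ≤ t) :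
    Measure.map (fun ω => X ω t - X ω s) P
      = Measure.map (fun x => |t - s| ^ H * x) (gaussianReal 0 1) := by
  obtain ⟨v, hv⟩ := hX.2.1 2 ![1, -1] ![t, s]
  have h1 := gauss_sq hv
  rw [fbm_var hX _ _ (by simp [Fin.forall_fin_two, hs, ht])] at h1
  have e : (fun ω => ∑ i, (![1, -1] : Fin 2 → ℝ) i * X ω ((![t, s] : Fin 2 → ℝ) i))
      = fun ω => X ω t - X ω s := by
    ext ω; simp [Fin.sum_univ_two, sub_eq_add_neg]
  rw [e] at hv
  rw [hv, gaussianReal_map_const_mul]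
  have h2 : (v : ℝ) = (|t - s| ^ H) ^ 2 := by
    rw [← h1, ← Real.rpow_natCast, ← Real.rpow_mul (abs_nonneg _)]
    simp only [covK, Fin.sum_univ_two, Matrix.cons_val_zero, Matrix.cons_val_one, sub_self,
      abs_zero, abs_sub_comm s t]
    rw [Real.zero_rpow (by positivity), mul_comm H]
    push_cast
    ring
  congr 1
  · simp
  · ext
    simp [h2]

end

lemma zeroNorm_scale (α H a l : ℝ) (hl : 0 < l) (g : ℝ → ℝ) :
    ENNReal.ofReal (l ^ (-(H + α - 1))) * zeroNorm α a (a + l) g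
      = zeroNorm α 0 1 (fun t => l ^ (-H) * (g (a + l * t) - g a)) := by
  have surj : Function.Surjective (fun t : ℝ => a + l * t) := fun y =>
    ⟨(y - a) / l, by field_simp; ring⟩
  unfold zeroNorm
  simp only [ENNReal.mul_iSup]
  symm
  refine surj.iSup_congr _ fun u => (surj.iSup_congr _ fun v => Eq.symm ?_).symm
  refine iSup_congr_Prop (by simp [hl]) fun _ => iSup_congr_Prop (by simp [hl]) fun huv =>
    iSup_congr_Prop ?_ fun _ => ?_
  · constructor
    · intro h; nlinarith
    · intro h; nlinarith
  symm
  replace huv : u < v := by nlinarith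
  rw [← ENNReal.ofReal_mul (by positivity)]
  congr 1
  have hc : (0 : ℝ) ≤ l ^ (-H) := by positivity
  rw [mul_add]
  congr 1
  · rw [← mul_sub, sub_sub_sub_cancel_right, abs_mul, abs_of_nonneg hc, add_sub_add_left_eq_sub,
      ← mul_sub, Real.mul_rpow hl.le (by linarith)]
    rw [show -(H + α - 1) = -H + (1 - α) by ring, Real.rpow_add hl]
    have : l ^ (1 - α) ≠ 0 := by positivity
    field_simp
  · rw [← integral_Ioc_eq_integral_Ioo, ← integral_Ioc_eq_integral_Ioo,
      ← intervalIntegral.integral_of_le huv.le,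
      ← intervalIntegral.integral_of_le (by nlinarith),
      ← intervalIntegral.mul_integral_comp_add_mul, ← mul_assoc,
      ← intervalIntegral.integral_const_mul]
    refine intervalIntegral.integral_congr fun z hz => ?_
    rw [uIcc_of_le huv.le] at hz
    rw [← mul_sub, sub_sub_sub_cancel_right, abs_mul, abs_of_nonneg hc, add_sub_add_left_eq_sub,
      ← mul_sub, Real.mul_rpow hl.le (by linarith [hz.1])]
    rw [show -(H + α - 1) = -H + (2 - α) + (-1) by ring, Real.rpow_add hl, Real.rpow_add hl,
      Real.rpow_neg_one]
    have : l ^ (2 - α) ≠ 0 := by positivity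
    field_simp

/-- Kolmogorov chaining: dyadic control implies Hölder control at small scales. -/
lemma chain {g : ℝ → ℝ} (hg : Continuous g) {β : ℝ} (hβ : 0 < β) {N : ℕ}
    (h : ∀ n ≥ N, ∀ k < 2 ^ n,
      |g (((k : ℕ) + 1 : ℝ) / 2 ^ n) - g ((k : ℝ) / 2 ^ n)| ≤ ((2 : ℝ) ^ (-β)) ^ n) :
    ∃ C : ℝ, 0 ≤ C ∧ ∀ u z : ℝ, 0 ≤ u → u < z → z < 1 → z - u ≤ (1 / 2) ^ N →
      |g z - g u| ≤ C * (z - u) ^ β := by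
  set r : ℝ := (2 : ℝ) ^ (-β) with hr
  have hr0 : 0 < r := by positivity
  have hr1 : r < 1 := Real.rpow_lt_one_of_one_lt_of_neg (by norm_num) (by linarith)
  set d : ℕ → ℝ → ℝ := fun n t => (⌊t * 2 ^ n⌋₊ : ℝ) / 2 ^ n with hd
  have fl : ∀ n (t : ℝ), 0 ≤ t → t < 1 → ⌊t * 2 ^ n⌋₊ < 2 ^ n := by
    intro n t h0 h1
    rw [Nat.floor_lt (by positivity)]
    push_cast
    have : (0 : ℝ) < 2 ^ n := by positivity
    nlinarith
  have stepA : ∀ t, 0 ≤ t → t < 1 → ∀ n ≥ N, |g (d n t) - g (d (n + 1) t)| ≤ r ^ (n + 1) := by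
    intro t h0 h1 n hn
    set m := ⌊t * 2 ^ n⌋₊ with hm
    have hx : 0 ≤ t * 2 ^ n := by positivity
    have m1 : (m : ℝ) ≤ t * 2 ^ n := Nat.floor_le hx
    have m2 : t * 2 ^ n < m + 1 := Nat.lt_floor_add_one _
    have hp : (0 : ℝ) < 2 ^ n := by positivity
    have hor : ⌊t * 2 ^ (n + 1)⌋₊ = 2 * m ∨ ⌊t * 2 ^ (n + 1)⌋₊ = 2 * m + 1 := by
      have e1 : 2 * m ≤ ⌊t * 2 ^ (n + 1)⌋₊ := by
        apply Nat.le_floor; push_cast; rw [pow_succ]; linarith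
      have e2 : ⌊t * 2 ^ (n + 1)⌋₊ < 2 * m + 2 := by
        rw [Nat.floor_lt (by positivity)]; push_cast; rw [pow_succ]; linarith
      omega
    have ed : d n t = ((2 * m : ℕ) : ℝ) / 2 ^ (n + 1) := by
      simp only [hd, ← hm]; push_cast; rw [pow_succ]; field_simp
    rw [ed]
    rcases hor with e | e
    · simp only [hd, e, sub_self, abs_zero]; positivity
    · have := h (n + 1) (by omega) (2 * m) (by
        have := fl n t h0 h1; rw [pow_succ]; omega)
      rw [abs_sub_comm]
      simp only [hd, e]
      push_cast at this ⊢
      exact this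
  have stepB : ∀ t, 0 ≤ t → t < 1 → ∀ n ≥ N, |g (d n t) - g t| ≤ r / (1 - r) * r ^ n := by
    intro t h0 h1 n hn
    have lim : Tendsto (fun j => g (d (n + j) t)) atTop (𝓝 (g t)) := by
      refine (hg.tendsto t).comp ?_
      have := (tendsto_nat_floor_mul_div_atTop h0).comp
        (tendsto_pow_atTop_atTop_of_one_lt (r := (2 : ℝ)) (by norm_num))
      have h2 := this.comp (tendsto_add_atTop_nat n)
      refine h2.congr fun j => ?_
      simp [hd, add_comm]
    have := dist_le_of_le_geometric_of_tendsto r (r ^ (n + 1)) hr1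
      (f := fun j => g (d (n + j) t)) (fun j => ?_) lim 0
    · simp only [Real.dist_eq, add_zero, pow_zero, mul_one] at this
      refine this.trans (le_of_eq ?_)
      rw [pow_succ]; ring
    · rw [Real.dist_eq]
      refine (stepA t h0 h1 (n + j) (by omega)).trans (le_of_eq ?_)
      rw [← pow_add]; congr 1; ring
  have stepC : ∀ u z, 0 ≤ u → u < z → z < 1 → ∀ n ≥ N, z - u ≤ (1 / 2) ^ n →
      |g (d n z) - g (d n u)| ≤ r ^ n := by
    intro u z h0 huz h1 n hn hzu
    have hp : (0 : ℝ) < 2 ^ n := by positivity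
    have e1 : ⌊u * 2 ^ n⌋₊ ≤ ⌊z * 2 ^ n⌋₊ := Nat.floor_le_floor (by nlinarith)
    have e2 : ⌊z * 2 ^ n⌋₊ ≤ ⌊u * 2 ^ n⌋₊ + 1 := by
      rw [← Nat.floor_add_one (by positivity)]
      apply Nat.floor_le_floor
      have : (z - u) * 2 ^ n ≤ (1 / 2) ^ n * 2 ^ n := by gcongr
      rw [← mul_pow] at this
      norm_num at this
      linarith
    have : ⌊z * 2 ^ n⌋₊ = ⌊u * 2 ^ n⌋₊ ∨ ⌊z * 2 ^ n⌋₊ = ⌊u * 2 ^ n⌋₊ + 1 := by omega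
    rcases this with e | e
    · simp only [hd, e, sub_self, abs_zero]; positivity
    · have := h n hn _ (fl n u h0 (by linarith))
      simp only [hd, e]
      push_cast
      exact this
  refine ⟨(1 + 2 * (r / (1 - r))) * 2 ^ β, ?_, ?_⟩
  · have : 0 < 1 - r := by linarith
    positivity
  intro u z h0 huz h1 hN
  obtain ⟨n, hn1, hn2⟩ := exists_nat_pow_near_of_lt_one (x := z - u) (y := (1 / 2 : ℝ))
    (by linarith) (by linarith) (by norm_num) (by norm_num)
  have hnN : n ≥ N := by
    have := (pow_lt_pow_iff_right_of_lt_one₀ (a := (1 / 2 : ℝ)) (by norm_num) (by norm_num)).1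
      (hn1.trans_le hN)
    omega
  have b1 := stepB z (by linarith) h1 n hnN
  have b2 := stepB u h0 (by linarith) n hnN
  have b3 := stepC u z h0 huz h1 n hnN hn2
  have tri : |g z - g u| ≤ (1 + 2 * (r / (1 - r))) * r ^ n := by
    rw [abs_le] at *
    constructor <;> linarith [b1.1, b1.2, b2.1, b2.2, b3.1, b3.2]
  refine tri.trans ?_
  rw [mul_assoc]
  have : 0 < 1 - r := by linarith
  gcongr
  have e : r ^ n = 2 ^ β * ((1 / 2 : ℝ) ^ (n + 1)) ^ β := by
    rw [← Real.mul_rpow (by norm_num) (by positivity), pow_succ, hr, ← Real.rpow_natCast,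
      ← Real.rpow_mul (by norm_num)]
    rw [show (2 : ℝ) * ((1 / 2) ^ n * (1 / 2)) = (1 / 2) ^ n by ring, one_div, inv_pow,
      ← Real.rpow_natCast, ← Real.rpow_neg (by norm_num), ← Real.rpow_mul (by norm_num)]
    congr 1; ring
  rw [e]
  gcongr

lemma holder_global {g : ℝ → ℝ} (hg : Continuous g) {β : ℝ} (hβ : 0 < β) {N : ℕ}
    (h : ∀ n ≥ N, ∀ k < 2 ^ n,
      |g (((k : ℕ) + 1 : ℝ) / 2 ^ n) - g ((k : ℝ) / 2 ^ n)| ≤ ((2 : ℝ) ^ (-β)) ^ n) :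
    ∃ C : ℝ, ∀ u z : ℝ, 0 ≤ u → u < z → z < 1 → |g z - g u| ≤ C * (z - u) ^ β := by
  obtain ⟨C, hC, h1⟩ := chain hg hβ h
  obtain ⟨M, hM⟩ := (isCompact_Icc (a := (0 : ℝ)) (b := 1)).exists_bound_of_continuousOn
    hg.continuousOn
  have hM0 : 0 ≤ M := (norm_nonneg _).trans (hM 0 (by simp))
  refine ⟨C + 2 * M / ((1 / 2) ^ N) ^ β, fun u z h0 huz hz => ?_⟩
  have hp : 0 ≤ (z - u) ^ β := Real.rpow_nonneg (by linarith) _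
  rcases le_or_gt (z - u) ((1 / 2) ^ N) with hs | hs
  · refine (h1 u z h0 huz hz hs).trans ?_
    gcongr
    have : 0 ≤ 2 * M / (((1 : ℝ) / 2) ^ N) ^ β := by positivity
    linarith
  · have a1 := hM u ⟨h0, by linarith⟩
    have a2 := hM z ⟨by linarith, by linarith⟩
    have a3 : |g z - g u| ≤ 2 * M := (abs_sub _ _).trans (by
      rw [Real.norm_eq_abs] at a1 a2; linarith)
    have hq : (0 : ℝ) < ((1 / 2) ^ N) ^ β := by positivity
    have a4 : (((1 : ℝ) / 2) ^ N) ^ β ≤ (z - u) ^ β := by gcongr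
    calc |g z - g u| ≤ 2 * M / ((1 / 2) ^ N) ^ β * ((1 / 2) ^ N) ^ β := by
          rw [div_mul_cancel₀ _ hq.ne']; exact a3
      _ ≤ 2 * M / ((1 / 2) ^ N) ^ β * (z - u) ^ β := by gcongr
      _ ≤ _ := by nlinarith

lemma holder_integrable {g : ℝ → ℝ} (hg : Continuous g) {α β C : ℝ} (hαβ : -1 < β + α - 2)
    (h : ∀ u z : ℝ, 0 ≤ u → u < z → z < 1 → |g z - g u| ≤ C * (z - u) ^ β)
    {u v : ℝ} (hu : 0 ≤ u) (huv : u < v) (hv : v < 1) :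
    IntegrableOn (fun z => |g u - g z| / (z - u) ^ (2 - α)) (Ioo u v) := by
  have i1 : IntegrableOn (fun z => C * (z - u) ^ (β + α - 2)) (Ioo u v) := by
    have := (intervalIntegral.intervalIntegrable_rpow' (a := 0) (b := v - u) hαβ).comp_sub_right u
    rw [zero_add, sub_add_cancel, intervalIntegrable_iff_integrableOn_Ioo_of_le huv.le] at this
    exact this.const_mul C
  refine Integrable.mono' i1 ?_ ?_
  · apply Measurable.aestronglyMeasurable
    have := hg.measurable
    fun_prop
  · refine (ae_restrict_iff' measurableSet_Ioo).2 (.of_forall fun z hz => ?_)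
    have hzu : 0 < z - u := by linarith [hz.1]
    rw [Real.norm_eq_abs, abs_of_nonneg (by positivity), div_le_iff₀ (by positivity), mul_assoc,
      ← Real.rpow_add hzu, show β + α - 2 + (2 - α) = β by ring, abs_sub_comm]
    exact h u z hu hz.1 (hz.2.trans hv)

lemma fbm_tail {Ω : Type*} [MeasurableSpace Ω] {P : Measure Ω} {H : ℝ} {X : Ω → ℝ → ℝ}
    (hX : IsFBM P H X) (hH : 0 < H) {s t : ℝ} (hs : 0 ≤ s) (ht : 0 ≤ t) (p : ℕ) {c : ℝ}
    (hc : 0 < c) :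
    P {ω | c < |X ω t - X ω s|} ≤
      (∫⁻ x, ‖x‖ₑ ^ p ∂(gaussianReal 0 1)) * ENNReal.ofReal ((|t - s| ^ H / c) ^ p) := by
  have aem : AEMeasurable (fun ω => X ω t - X ω s) P := (fbm_aem hX t).sub (fbm_aem hX s)
  have h1 : ∫⁻ ω, ‖X ω t - X ω s‖ₑ ^ p ∂P
      = ENNReal.ofReal (|t - s| ^ H) ^ p * ∫⁻ x, ‖x‖ₑ ^ p ∂(gaussianReal 0 1) := by
    have e1 : ∫⁻ x, ‖x‖ₑ ^ p ∂(Measure.map (fun ω => X ω t - X ω s) P)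
        = ∫⁻ ω, ‖X ω t - X ω s‖ₑ ^ p ∂P := lintegral_map' (by fun_prop) aem
    rw [← e1, fbm_incr hX hH hs ht, lintegral_map (by fun_prop) (by fun_prop),
      ← lintegral_const_mul _ (by fun_prop)]
    congr 1
    ext x
    rw [enorm_mul, mul_pow, Real.enorm_eq_ofReal (by positivity)]
  have h2 := mul_meas_ge_le_lintegral₀ (μ := P) (f := fun ω => ‖X ω t - X ω s‖ₑ ^ p)
    (by fun_prop) (ENNReal.ofReal c ^ p)
  rw [h1] at h2
  have h3 : P {ω | c < |X ω t - X ω s|}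
      ≤ P {ω | ENNReal.ofReal c ^ p ≤ ‖X ω t - X ω s‖ₑ ^ p} := by
    refine measure_mono fun ω hω => ?_
    simp only [mem_ofPred_eq] at hω ⊢
    gcongr
    rw [Real.enorm_eq_ofReal_abs]
    exact ENNReal.ofReal_le_ofReal hω.le
  refine h3.trans ?_
  have hc0 : ENNReal.ofReal c ^ p ≠ 0 := by simp [hc]
  have hct : ENNReal.ofReal c ^ p ≠ ⊤ := by simp
  rw [mul_comm] at h2
  have h4 := (ENNReal.le_div_iff_mul_le (Or.inl hc0) (Or.inl hct)).2 h2
  refine h4.trans (le_of_eq ?_)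
  rw [div_pow, ENNReal.ofReal_div_of_pos (by positivity), ENNReal.ofReal_pow (by positivity),
    ENNReal.ofReal_pow (by positivity), mul_comm, mul_div_assoc]

lemma gauss_moment (p : ℕ) : ∫⁻ x, ‖x‖ₑ ^ p ∂(gaussianReal 0 1) ≠ ⊤ := by
  rcases Nat.eq_zero_or_pos p with rfl | hp
  · simp
  have h := (memLp_id_gaussianReal (μ := 0) (v := 1) p).eLpNorm_lt_top
  have h2 := lintegral_rpow_enorm_lt_top_of_eLpNorm_lt_top (p := ((p : ℝ≥0) : ℝ≥0∞))
    (by simp; omega) (by simp) h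
  simpa using h2.ne

lemma fbm_holder {Ω : Type*} [MeasurableSpace Ω] {P : Measure Ω} {H : ℝ} {X : Ω → ℝ → ℝ}
    (hX : IsFBM P H X) {β : ℝ} (hβ : 0 < β) (hβH : β < H) :
    ∀ᵐ ω ∂P, ∃ C : ℝ, ∀ u z : ℝ, 0 ≤ u → u < z → z < 1 →
      |X ω z - X ω u| ≤ C * (z - u) ^ β := by
  have hH : 0 < H := hβ.trans hβH
  obtain ⟨p, hp⟩ := exists_nat_gt (1 / (H - β))
  have hp' : 1 < (H - β) * p := by
    rw [div_lt_iff₀ (by linarith)] at hp; linarith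
  set K := ∫⁻ x, ‖x‖ₑ ^ p ∂(gaussianReal 0 1) with hK
  set r : ℝ := (2 : ℝ) ^ (-β) with hr
  have hr0 : 0 < r := by positivity
  set S : ℕ → Set Ω := fun n => ⋃ k ∈ Finset.range (2 ^ n),
    {ω | r ^ n < |X ω (((k : ℕ) + 1 : ℝ) / 2 ^ n) - X ω ((k : ℝ) / 2 ^ n)|} with hS
  set ρ : ℝ := 2 * 2 ^ (-((H - β) * p)) with hρ
  have hρ1 : ρ < 1 := by
    have : (2 : ℝ) ^ (-((H - β) * p)) < 2 ^ (-1 : ℝ) :=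
      Real.rpow_lt_rpow_of_exponent_lt (by norm_num) (by linarith)
    rw [Real.rpow_neg_one] at this
    rw [hρ]; linarith
  have hρ0 : 0 ≤ ρ := by positivity
  have bound : ∀ n, P (S n) ≤ K * ENNReal.ofReal ρ ^ n := by
    intro n
    have each : ∀ k ∈ Finset.range (2 ^ n),
        P {ω | r ^ n < |X ω (((k : ℕ) + 1 : ℝ) / 2 ^ n) - X ω ((k : ℝ) / 2 ^ n)|}
          ≤ K * ENNReal.ofReal ((ρ / 2) ^ n) := by
      intro k _
      refine (fbm_tail hX hH (by positivity) (by positivity) p (by positivity)).trans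
        (le_of_eq ?_)
      congr 2
      have e1 : |((k : ℝ) + 1) / 2 ^ n - k / 2 ^ n| = (2 : ℝ) ^ (-(n : ℝ)) := by
        rw [← sub_div, add_sub_cancel_left, abs_of_pos (by positivity), one_div,
          Real.rpow_neg (by norm_num), Real.rpow_natCast]
      rw [e1, hρ, hr, mul_div_cancel_left₀ _ (by norm_num : (2 : ℝ) ≠ 0)]
      simp only [← Real.rpow_natCast]
      rw [← Real.rpow_mul (by norm_num), ← Real.rpow_mul (by norm_num), ← Real.rpow_sub (by norm_num),
        ← Real.rpow_mul (by norm_num), ← Real.rpow_mul (by norm_num)]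
      congr 1; ring
    calc P (S n) ≤ ∑ k ∈ Finset.range (2 ^ n), _ := measure_biUnion_finset_le _ _
      _ ≤ ∑ k ∈ Finset.range (2 ^ n), K * ENNReal.ofReal ((ρ / 2) ^ n) := Finset.sum_le_sum each
      _ = K * ENNReal.ofReal ρ ^ n := by
        rw [Finset.sum_const, Finset.card_range, nsmul_eq_mul, mul_left_comm,
          ← ENNReal.ofReal_pow hρ0, ← ENNReal.ofReal_natCast, ← ENNReal.ofReal_mul (by positivity)]
        congr 2
        push_cast
        rw [← mul_pow]; congr 1; ring
  have summ : ∑' n, P (S n) ≠ ⊤ := by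
    refine ne_top_of_le_ne_top ?_ (ENNReal.tsum_le_tsum bound)
    rw [ENNReal.tsum_mul_left, ENNReal.tsum_geometric]
    refine ENNReal.mul_ne_top (gauss_moment p) (ENNReal.inv_ne_top.2 ?_)
    have : ENNReal.ofReal ρ < 1 := by
      rw [← ENNReal.ofReal_one]; exact (ENNReal.ofReal_lt_ofReal_iff (by norm_num)).2 hρ1
    exact (tsub_pos_of_lt this).ne'
  filter_upwards [hX.1, ae_eventually_notMem summ] with ω hω hev
  obtain ⟨N, hN⟩ := eventually_atTop.1 hev
  refine holder_global hω hβ (N := N) fun n hn k hk => ?_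
  have := hN n hn
  simp only [hS, mem_iUnion, not_exists, Finset.mem_range, mem_ofPred_eq, not_lt] at this
  exact this k hk

/-- Rational approximation of a nonnegative real. -/
noncomputable def ratApp (n : ℕ) (z : ℝ) : ℚ≥0 := (⌊z * n⌋₊ : ℚ≥0) / n

lemma ratApp_tendsto {z : ℝ} (hz : 0 ≤ z) :
    Tendsto (fun n => ((ratApp n z : ℚ≥0) : ℝ)) atTop (𝓝 z) := by
  have := (tendsto_nat_floor_mul_div_atTop hz).comp (tendsto_natCast_atTop_atTop (R := ℝ))
  refine this.congr fun n => ?_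
  simp [ratApp]

/-- The functional on paths restricted to nonnegative rationals. -/
noncomputable def ratNorm (α : ℝ) (r : ℚ≥0 → ℝ) : ℝ≥0∞ :=
  ⨆ (u : ℚ≥0) (v : ℚ≥0) (_ : u < v) (_ : v < 1),
    (ENNReal.ofReal (|r v - r u| / ((v : ℝ) - u) ^ (1 - α))
      + ∫⁻ z in Ioo (u : ℝ) v,
        liminf (fun n => ENNReal.ofReal (|r u - r (ratApp n z)| / (z - u) ^ (2 - α))) atTop)

lemma measurable_ratNorm (α : ℝ) : Measurable (ratNorm α) := by
  unfold ratNorm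
  refine Measurable.iSup fun u => Measurable.iSup fun v => Measurable.iSup fun _ =>
    Measurable.iSup fun _ => ?_
  have m1 : Measurable (fun r : ℚ≥0 → ℝ =>
      ENNReal.ofReal (|r v - r u| / ((v : ℝ) - u) ^ (1 - α))) := by fun_prop
  refine m1.add ?_
  refine Measurable.lintegral_prod_right' (f := fun p : (ℚ≥0 → ℝ) × ℝ =>
    liminf (fun n => ENNReal.ofReal (|p.1 u - p.1 (ratApp n p.2)| / (p.2 - u) ^ (2 - α))) atTop) ?_
  refine Measurable.liminf fun n => ?_
  have h1 : Measurable (fun p : (ℚ≥0 → ℝ) × ℕ => p.1 ((p.2 : ℚ≥0) / n)) :=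
    measurable_from_prod_countable_left fun k => measurable_pi_apply ((k : ℚ≥0) / n)
  have h2 : Measurable (fun p : (ℚ≥0 → ℝ) × ℝ => p.1 (ratApp n p.2)) :=
    h1.comp (g := fun p : (ℚ≥0 → ℝ) × ℕ => p.1 ((p.2 : ℚ≥0) / n))
      (f := fun p : (ℚ≥0 → ℝ) × ℝ => (p.1, ⌊p.2 * n⌋₊))
      (measurable_fst.prodMk (Nat.measurable_floor.comp (by fun_prop)))
  fun_prop

lemma ratNorm_eq {g : ℝ → ℝ} (hg : Continuous g) (α : ℝ)
    (hi : ∀ u v : ℝ, 0 ≤ u → u < v → v < 1 →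
      IntegrableOn (fun z => |g u - g z| / (z - u) ^ (2 - α)) (Ioo u v)) :
    zeroNorm α 0 1 g = ratNorm α (fun q => g q) := by
  set J : ℝ → ℝ → ℝ≥0∞ := fun u v =>
    ∫⁻ z in Ioo u v, ENNReal.ofReal (|g u - g z| / (z - u) ^ (2 - α)) with hJ
  set A : ℝ → ℝ → ℝ≥0∞ := fun u v => ENNReal.ofReal (|g v - g u| / (v - u) ^ (1 - α)) with hA
  have e1 : ∀ u v : ℝ, 0 ≤ u → u < v → v < 1 → ENNReal.ofReal (|g v - g u| / (v - u) ^ (1 - α)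
      + ∫ z in Ioo u v, |g u - g z| / (z - u) ^ (2 - α)) = A u v + J u v := by
    intro u v hu huv hv
    have nn : 0 ≤ᵐ[volume.restrict (Ioo u v)] fun z => |g u - g z| / (z - u) ^ (2 - α) := by
      refine (ae_restrict_iff' measurableSet_Ioo).2 (.of_forall fun z hz => ?_)
      have : 0 < z - u := by linarith [hz.1]
      simp only [Pi.zero_apply]
      positivity
    have hvu : 0 < v - u := by linarith
    rw [ENNReal.ofReal_add (by positivity) (integral_nonneg_of_ae nn),
      ofReal_integral_eq_lintegral_ofReal (hi u v hu huv hv) nn]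
  have e2 : ratNorm α (fun q => g q)
      = ⨆ (u : ℚ≥0) (v : ℚ≥0) (_ : u < v) (_ : v < 1), (A u v + J u v) := by
    unfold ratNorm
    refine iSup_congr fun u => iSup_congr fun v => iSup_congr fun _ => iSup_congr fun _ => ?_
    congr 1
    refine setLIntegral_congr_fun measurableSet_Ioo fun z hz => ?_
    have hz0 : 0 ≤ z := le_trans (by positivity) hz.1.le
    refine Tendsto.liminf_eq ?_
    refine (ENNReal.continuous_ofReal.tendsto _).comp ?_
    have := (hg.tendsto z).comp (ratApp_tendsto hz0)
    exact ((tendsto_const_nhds.sub this).abs).div_const _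
  have e3 : zeroNorm α 0 1 g = ⨆ (u : ℝ) (v : ℝ) (_ : 0 ≤ u) (_ : u < v) (_ : v < 1),
      (A u v + J u v) := by
    unfold zeroNorm
    exact iSup_congr fun u => iSup_congr fun v => iSup_congr fun h0 => iSup_congr fun h1 =>
      iSup_congr fun h2 => e1 u v h0 h1 h2
  rw [e3, e2]
  refine le_antisymm ?_ ?_
  · refine iSup_le fun u => iSup_le fun v => iSup_le fun hu => iSup_le fun huv =>
      iSup_le fun hv => ?_
    set S := ⨆ (u : ℚ≥0) (v : ℚ≥0) (_ : u < v) (_ : v < 1), (A u v + J u v) with hS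
    have tu := ratApp_tendsto hu
    have tv := ratApp_tendsto (hu.trans huv.le)
    have ev : ∀ᶠ n in atTop, A (ratApp n u) (ratApp n v) + J (ratApp n u) (ratApp n v) ≤ S := by
      filter_upwards [tu.eventually_lt tv huv, tv.eventually_lt_const hv] with n h1 h2
      have h1' : ratApp n u < ratApp n v := by exact_mod_cast h1
      have h2' : ratApp n v < 1 := by exact_mod_cast h2
      exact le_iSup_of_le (ratApp n u) (le_iSup_of_le (ratApp n v)
        (le_iSup_of_le h1' (le_iSup_of_le h2' le_rfl)))
    have tA : Tendsto (fun n => A (ratApp n u) (ratApp n v)) atTop (𝓝 (A u v)) := by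
      refine (ENNReal.continuous_ofReal.tendsto _).comp ?_
      have hvu : v - u ≠ 0 := by linarith
      have hne : (v - u) ^ (1 - α) ≠ 0 := (Real.rpow_pos_of_pos (by linarith) _).ne'
      exact ((((hg.tendsto v).comp tv).sub ((hg.tendsto u).comp tu)).abs).div
        ((tv.sub tu).rpow_const (Or.inl hvu)) hne
    have AS : A u v ≤ S := le_of_tendsto tA (ev.mono fun n hn => le_self_add.trans hn)
    have JS : J u v ≤ S - A u v := by
      have gm := hg.measurable
      have f1 : J u v ≤ liminf (fun n => J (ratApp n u) (ratApp n v)) atTop := by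
        simp only [hJ, ← lintegral_indicator measurableSet_Ioo]
        refine le_trans (lintegral_mono fun z => ?_) (lintegral_liminf_le fun n => ?_)
        · by_cases hz : z ∈ Ioo u v
          · rw [indicator_of_mem hz]
            have hzu : z - u ≠ 0 := by linarith [hz.1]
            have hne : (z - u) ^ (2 - α) ≠ 0 :=
              (Real.rpow_pos_of_pos (by linarith [hz.1]) _).ne'
            have t1 : Tendsto (fun n => ENNReal.ofReal (|g (ratApp n u) - g z|
                / (z - ratApp n u) ^ (2 - α))) atTop
                (𝓝 (ENNReal.ofReal (|g u - g z| / (z - u) ^ (2 - α)))) := by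
              refine (ENNReal.continuous_ofReal.tendsto _).comp ?_
              exact ((((hg.tendsto u).comp tu).sub tendsto_const_nhds).abs).div
                ((tendsto_const_nhds.sub tu).rpow_const (Or.inl hzu)) hne
            refine (Tendsto.liminf_eq (t1.congr' ?_)).ge
            filter_upwards [tu.eventually_lt_const hz.1, tv.eventually_const_lt hz.2]
              with n h1 h2
            rw [indicator_of_mem (mem_Ioo.2 ⟨h1, h2⟩)]
          · rw [indicator_of_notMem hz]; exact zero_le
        · refine Measurable.indicator ?_ measurableSet_Ioo
          fun_prop
      refine f1.trans ?_
      have tS : Tendsto (fun n => S - A (ratApp n u) (ratApp n v)) atTop (𝓝 (S - A u v)) :=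
        ENNReal.Tendsto.sub tendsto_const_nhds tA (Or.inr ENNReal.ofReal_ne_top)
      rw [← tS.liminf_eq]
      exact liminf_le_liminf (ev.mono fun n hn =>
        ENNReal.le_sub_of_add_le_left ENNReal.ofReal_ne_top hn)
    calc A u v + J u v ≤ A u v + (S - A u v) := by gcongr
      _ = S := add_tsub_cancel_of_le AS
  · refine iSup_le fun u => iSup_le fun v => iSup_le fun huv => iSup_le fun hv => ?_
    exact le_iSup_of_le (u : ℝ) (le_iSup_of_le (v : ℝ) (le_iSup_of_le (by positivity)
      (le_iSup_of_le (by exact_mod_cast huv) (le_iSup_of_le (by exact_mod_cast hv) le_rfl))))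

lemma zeroNorm_ae {Ω : Type*} [MeasurableSpace Ω] {P : Measure Ω} {H α : ℝ} {X : Ω → ℝ → ℝ}
    (hH : H ∈ Set.Ioo (1 / 2 : ℝ) 1) (hα : α ∈ Set.Ioo (1 - H) (1 / 2)) (hX : IsFBM P H X) :
    ∀ᵐ ω ∂P, zeroNorm α 0 1 (X ω) = ratNorm α (fun q => X ω q) := by
  obtain ⟨β, h1, h2⟩ := exists_between (show 1 - α < H by linarith [hα.1])
  filter_upwards [hX.1, fbm_holder hX (β := β) (by linarith [hα.2]) h2] with ω hω ⟨C, hC⟩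
  exact ratNorm_eq hω α fun u v hu huv hv => holder_integrable hω (by linarith) hC hu huv hv

lemma law_eq {Ω : Type*} [MeasurableSpace Ω] {P : Measure Ω} [IsProbabilityMeasure P]
    {H α : ℝ} {X Y : Ω → ℝ → ℝ}
    (hH : H ∈ Set.Ioo (1 / 2 : ℝ) 1) (hα : α ∈ Set.Ioo (1 - H) (1 / 2)) (hX : IsFBM P H X)
    (hY : IsFBM P H Y) :
    Measure.map (fun ω => (zeroNorm α 0 1 (X ω)).toReal) P
      = Measure.map (fun ω => (zeroNorm α 0 1 (Y ω)).toReal) P := by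
  have key : ∀ Z : Ω → ℝ → ℝ, IsFBM P H Z →
      Measure.map (fun ω => (zeroNorm α 0 1 (Z ω)).toReal) P
        = Measure.map (fun r => (ratNorm α r).toReal)
          (Measure.map (fun ω => fun q : ℚ≥0 => Z ω q) P) := by
    intro Z hZ
    rw [AEMeasurable.map_map_of_aemeasurable
      (measurable_ratNorm α).ennreal_toReal.aemeasurable
      (aemeasurable_pi_lambda _ fun q => fbm_aem hZ q)]
    refine Measure.map_congr ?_
    filter_upwards [zeroNorm_ae hH hα hZ] with ω hω
    simp [hω]
  rw [key X hX, key Y hY, fbm_law hX hY]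

theorem zeroNorm_fbm_self_similar {Ω : Type*} [MeasurableSpace Ω]
    (P : Measure Ω) [IsProbabilityMeasure P] (H α : ℝ) (B : Ω → ℝ → ℝ)
    (hH : H ∈ Set.Ioo (1 / 2 : ℝ) 1) (hα : α ∈ Set.Ioo (1 - H) (1 / 2))
    (hB : IsFBM P H B) :
    ∀ a b : ℝ, 0 ≤ a → a < b →
      Measure.map (fun ω => (b - a) ^ (-(H + α - 1)) * (zeroNorm α a b (B ω)).toReal) P =
        Measure.map (fun ω => (zeroNorm α 0 1 (B ω)).toReal) P := by
  intro a b ha hab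
  have hl : 0 < b - a := by linarith
  rw [← law_eq hH hα (fbm_affine hB ha hl (by linarith [hH.1])) hB]
  congr 1
  ext ω
  rw [← zeroNorm_scale α H a (b - a) hl (B ω), ENNReal.toReal_mul,
    ENNReal.toReal_ofReal (by positivity), add_sub_cancel]
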